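/- arXiv:2510.19534 — 2 statements merged into one kernel-verified Lean document; each statement's English description precedes it below -/
import Mathlib

section
/- Let n ≥ 1, n < p < +∞, and γ ∈ ℝ with γ < p − n. There exists a constant C > 0, depending only on n, γ and p, such that every function u : ℝⁿ → ℝ that is continuously differentiable on ℝⁿ₊ satisfies, for all x ∈ ℝⁿ₊ and all R > 0, (1/|C_R(x)|) ∫_{C_R(x)} |u(x) − u(z)| dz ≤ C · max(xₙ, R)^{−γ/p} · R^{1 − n/p} · ( ∫_{C_R(x)} ‖Du(z)‖^p zₙ^γ dz )^{1/p}. -/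
open MeasureTheory Real Set
open scoped ENNReal

noncomputable section

/-- The last coordinate `xₙ` of a point of `ℝⁿ`. -/
def lastCoord (n : ℕ) (x : EuclideanSpace ℝ (Fin n)) : ℝ :=
  if h : 0 < n then x ⟨n - 1, Nat.sub_lt h one_pos⟩ else 0

/-- The open upper half-space `ℝⁿ₊`. -/
def upperHalf (n : ℕ) : Set (EuclideanSpace ℝ (Fin n)) :=
  {z | 0 < lastCoord n z}

/-- The weighted energy `E_γ(u) = ∫_{ℝⁿ₊} ‖Du(z)‖^p zₙ^γ dz`, as a value in `[0, +∞]`. -/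
def energy (n : ℕ) (γ p : ℝ) (u : EuclideanSpace ℝ (Fin n) → ℝ) : ℝ≥0∞ :=
  ∫⁻ z in upperHalf n, ENNReal.ofReal (‖fderiv ℝ u z‖ ^ p * lastCoord n z ^ γ)

/-- The Euclidean norm of the first `n - 1` coordinates of a point of `ℝⁿ`,
i.e. `|x′|` where `x = (x′, xₙ)`. -/
def sideNorm (n : ℕ) (x : EuclideanSpace ℝ (Fin n)) : ℝ :=
  Real.sqrt (∑ i ∈ Finset.univ.filter (fun i : Fin n => (i : ℕ) < n - 1), x i ^ 2)

/-- The upward cone `C_R(x) = {z ∈ ℝⁿ : |z′ − x′| < zₙ − xₙ < R}`. -/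
def cone (n : ℕ) (R : ℝ) (x : EuclideanSpace ℝ (Fin n)) : Set (EuclideanSpace ℝ (Fin n)) :=
  {z | sideNorm n (z - x) < lastCoord n (z - x) ∧ lastCoord n (z - x) < R}

lemma lastCoord_add (n : ℕ) (x y : EuclideanSpace ℝ (Fin n)) :
    lastCoord n (x + y) = lastCoord n x + lastCoord n y := by
  unfold lastCoord
  split_ifs <;> simp

lemma lastCoord_smul (n : ℕ) (t : ℝ) (x : EuclideanSpace ℝ (Fin n)) :
    lastCoord n (t • x) = t * lastCoord n x := by
  unfold lastCoord
  split_ifs <;> simp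

lemma continuous_lastCoord (n : ℕ) : Continuous (lastCoord n) := by
  unfold lastCoord
  split_ifs <;> fun_prop

lemma continuous_sideNorm (n : ℕ) : Continuous (sideNorm n) := by
  unfold sideNorm
  fun_prop

lemma sideNorm_nonneg (n : ℕ) (x : EuclideanSpace ℝ (Fin n)) : 0 ≤ sideNorm n x :=
  Real.sqrt_nonneg _

lemma sideNorm_smul (n : ℕ) {t : ℝ} (ht : 0 ≤ t) (x : EuclideanSpace ℝ (Fin n)) :
    sideNorm n (t • x) = t * sideNorm n x := by
  simp only [sideNorm, PiLp.smul_apply, smul_eq_mul, mul_pow, ← Finset.mul_sum]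
  rw [Real.sqrt_mul (sq_nonneg t), Real.sqrt_sq ht]

lemma norm_sq_eq_sideNorm_sq_add {n : ℕ} (hn : 1 ≤ n) (x : EuclideanSpace ℝ (Fin n)) :
    ‖x‖ ^ 2 = sideNorm n x ^ 2 + lastCoord n x ^ 2 := by
  rw [EuclideanSpace.norm_sq_eq, sideNorm, Real.sq_sqrt (Finset.sum_nonneg fun i _ => sq_nonneg _),
    lastCoord, dif_pos (by omega : 0 < n),
    ← Finset.sum_filter_add_sum_filter_not Finset.univ (fun i : Fin n => (i : ℕ) < n - 1)]
  have hlast : Finset.univ.filter (fun i : Fin n => ¬ (i : ℕ) < n - 1)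
      = {⟨n - 1, Nat.sub_lt hn one_pos⟩} := by
    ext i
    simp only [Finset.mem_filter, Finset.mem_univ, true_and, Finset.mem_singleton, Fin.ext_iff]
    omega
  rw [hlast, Finset.sum_singleton]
  simp

lemma isOpen_upperHalf (n : ℕ) : IsOpen (upperHalf n) :=
  isOpen_lt continuous_const (continuous_lastCoord n)

lemma isOpen_cone (n : ℕ) (R : ℝ) (x : EuclideanSpace ℝ (Fin n)) : IsOpen (cone n R x) := by
  have hsub : Continuous fun z => z - x := by fun_prop
  have hlast := (continuous_lastCoord n).comp hsub
  exact (isOpen_lt ((continuous_sideNorm n).comp hsub) hlast).inter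
    (isOpen_lt hlast continuous_const)

lemma measurableSet_cone (n : ℕ) (R : ℝ) (x : EuclideanSpace ℝ (Fin n)) :
    MeasurableSet (cone n R x) :=
  (isOpen_cone n R x).measurableSet

lemma mem_cone_zero {n : ℕ} {R : ℝ} {y : EuclideanSpace ℝ (Fin n)} :
    y ∈ cone n R 0 ↔ sideNorm n y < lastCoord n y ∧ lastCoord n y < R := by
  simp [cone]

lemma lastCoord_pos_of_mem_cone_zero {n : ℕ} {R : ℝ} {y : EuclideanSpace ℝ (Fin n)}
    (hy : y ∈ cone n R 0) : 0 < lastCoord n y :=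
  (sideNorm_nonneg n y).trans_lt (mem_cone_zero.1 hy).1

lemma norm_le_two_mul_lastCoord {n : ℕ} (hn : 1 ≤ n) {R : ℝ} {y : EuclideanSpace ℝ (Fin n)}
    (hy : y ∈ cone n R 0) : ‖y‖ ≤ 2 * lastCoord n y := by
  have h := norm_sq_eq_sideNorm_sq_add hn y
  have h1 := (mem_cone_zero.1 hy).1
  have h0 := sideNorm_nonneg n y
  refine abs_le_of_sq_le_sq' ?_ (by linarith) |>.2
  nlinarith

lemma cone_mono (n : ℕ) {r R : ℝ} (h : r ≤ R) (x : EuclideanSpace ℝ (Fin n)) :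
    cone n r x ⊆ cone n R x :=
  fun _ hz => ⟨hz.1, hz.2.trans_le h⟩

lemma preimage_smul_cone_zero (n : ℕ) {t : ℝ} (ht : 0 < t) (R : ℝ) :
    (t • ·) ⁻¹' cone n (t * R) 0 = cone n R 0 := by
  ext y
  simp only [mem_preimage, mem_cone_zero, lastCoord_smul, sideNorm_smul n ht.le,
    mul_lt_mul_iff_right₀ ht]

lemma preimage_add_cone (n : ℕ) (R : ℝ) (x : EuclideanSpace ℝ (Fin n)) :
    (x + ·) ⁻¹' cone n R x = cone n R 0 := by
  ext y
  simp [cone]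

lemma setLIntegral_cone_eq (n : ℕ) (R : ℝ) (x : EuclideanSpace ℝ (Fin n))
    (f : EuclideanSpace ℝ (Fin n) → ℝ≥0∞) :
    ∫⁻ z in cone n R x, f z = ∫⁻ y in cone n R 0, f (x + y) := by
  rw [← preimage_add_cone n R x,
    (measurePreserving_add_left volume x).setLIntegral_comp_preimage_emb
      (measurableEmbedding_addLeft x)]

lemma volume_cone_eq (n : ℕ) (R : ℝ) (x : EuclideanSpace ℝ (Fin n)) :
    volume (cone n R x) = volume (cone n R 0) := by
  rw [← setLIntegral_one, ← setLIntegral_one, setLIntegral_cone_eq n R x]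

lemma setLIntegral_cone_comp_smul (n : ℕ) {t : ℝ} (ht : 0 < t) (R : ℝ)
    (f : EuclideanSpace ℝ (Fin n) → ℝ≥0∞) :
    ∫⁻ y in cone n R 0, f (t • y)
      = ENNReal.ofReal (t ^ (-(n : ℝ))) * ∫⁻ y in cone n (t * R) 0, f y := by
  have hemb : MeasurableEmbedding (fun y : EuclideanSpace ℝ (Fin n) => t • y) :=
    (Homeomorph.smulOfNeZero t ht.ne').measurableEmbedding
  rw [← preimage_smul_cone_zero n ht R, ← hemb.lintegral_map, ← hemb.restrict_map,
    Measure.map_addHaar_smul volume ht.ne', Measure.restrict_smul, lintegral_smul_measure,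
    finrank_euclideanSpace_fin, abs_of_pos (by positivity), Real.rpow_neg ht.le,
    Real.rpow_natCast, smul_eq_mul]

lemma volume_cone_zero (n : ℕ) {R : ℝ} (hR : 0 < R) :
    volume (cone n R 0) = ENNReal.ofReal (R ^ (n : ℝ)) * volume (cone n 1 0) := by
  have h := setLIntegral_cone_comp_smul n (inv_pos.2 hR) R (fun _ => 1)
  rwa [setLIntegral_one, setLIntegral_one, inv_mul_cancel₀ hR.ne', Real.inv_rpow hR.le,
    Real.rpow_neg hR.le, inv_inv] at h

lemma cone_one_subset_ball {n : ℕ} (hn : 1 ≤ n) : cone n 1 0 ⊆ Metric.ball 0 2 := by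
  intro y hy
  rw [mem_ball_zero_iff]
  linarith [norm_le_two_mul_lastCoord hn hy, (mem_cone_zero.1 hy).2]

lemma volume_cone_one_ne_top {n : ℕ} (hn : 1 ≤ n) : volume (cone n 1 0) ≠ ∞ :=
  ((measure_mono (cone_one_subset_ball hn)).trans_lt measure_ball_lt_top).ne

lemma volume_cone_one_ne_zero {n : ℕ} (hn : 1 ≤ n) : volume (cone n 1 0) ≠ 0 := by
  refine ((isOpen_cone n 1 0).measure_pos _
    ⟨EuclideanSpace.single ⟨n - 1, Nat.sub_lt hn one_pos⟩ (1 / 2), mem_cone_zero.2 ?_⟩).ne'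
  have hside : sideNorm n (EuclideanSpace.single ⟨n - 1, Nat.sub_lt hn one_pos⟩ (1 / 2)) = 0 := by
    rw [sideNorm, Finset.sum_eq_zero, Real.sqrt_zero]
    intro i hi
    have : i ≠ ⟨n - 1, Nat.sub_lt hn one_pos⟩ := by
      rintro rfl
      simp at hi
    simp [this]
  rw [hside, lastCoord, dif_pos (by omega : 0 < n)]
  norm_num

lemma setLIntegral_cone_one_rpow_lt_top {n : ℕ} (hn : 1 ≤ n) {s : ℝ} (hs0 : 0 ≤ s) (hs : s < n) :
    ∫⁻ y in cone n 1 0, ENNReal.ofReal (lastCoord n y ^ (-s)) < ∞ := by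
  have hint : IntegrableOn (fun y : EuclideanSpace ℝ (Fin n) => (‖y‖ / 2) ^ (-s))
      (Metric.ball 0 2) := by
    refine integrableOn_ball_of_norm_le_rpow (C := (1 / 2) ^ (-s)) (α := s) ?_ ?_ ?_ ?_
    · simpa using hn
    · simpa using hs
    · refine .of_forall fun y => ?_
      rw [div_eq_mul_one_div, Real.mul_rpow (norm_nonneg y) (by norm_num),
        Real.norm_of_nonneg (by positivity), mul_comm]
    · exact Measurable.aestronglyMeasurable (by fun_prop)
  refine lt_of_le_of_lt (setLIntegral_mono_ae' (measurableSet_cone n 1 0)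
    (.of_forall fun y hy => ENNReal.ofReal_le_ofReal ?_))
    ((hint.mono_set (cone_one_subset_ball hn)).lintegral_lt_top)
  have hy0 := lastCoord_pos_of_mem_cone_zero hy
  have hpos : 0 < ‖y‖ := by
    rw [norm_pos_iff]
    rintro rfl
    simp [lastCoord] at hy0
  exact Real.rpow_le_rpow_of_nonpos (by positivity)
    (by linarith [norm_le_two_mul_lastCoord hn hy]) (by linarith)

lemma setLIntegral_cone_div_rpow (n : ℕ) {R : ℝ} (hR : 0 < R) (s : ℝ) :
    ∫⁻ y in cone n R 0, ENNReal.ofReal ((lastCoord n y / R) ^ (-s))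
      = ENNReal.ofReal (R ^ (n : ℝ)) *
        ∫⁻ y in cone n 1 0, ENNReal.ofReal (lastCoord n y ^ (-s)) := by
  have h := setLIntegral_cone_comp_smul n (inv_pos.2 hR) R
    (fun y => ENNReal.ofReal (lastCoord n y ^ (-s)))
  simp only [lastCoord_smul] at h
  rw [inv_mul_cancel₀ hR.ne', Real.inv_rpow hR.le, Real.rpow_neg hR.le, inv_inv] at h
  simpa only [div_eq_inv_mul] using h

lemma add_smul_mem_upperHalf {n : ℕ} {R : ℝ} {x y : EuclideanSpace ℝ (Fin n)}
    (hx : x ∈ upperHalf n) (hy : y ∈ cone n R 0) {t : ℝ} (ht : 0 ≤ t) :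
    x + t • y ∈ upperHalf n := by
  have hx' : 0 < lastCoord n x := hx
  have hy' := lastCoord_pos_of_mem_cone_zero hy
  change 0 < lastCoord n (x + t • y)
  rw [lastCoord_add, lastCoord_smul]
  positivity

lemma enorm_sub_le_lintegral_enorm_fderiv {n : ℕ} {u : EuclideanSpace ℝ (Fin n) → ℝ}
    (hu : ContDiffOn ℝ 1 u (upperHalf n)) {R : ℝ} {x y : EuclideanSpace ℝ (Fin n)}
    (hx : x ∈ upperHalf n) (hy : y ∈ cone n R 0) :
    ‖u x - u (x + y)‖ₑ ≤ ∫⁻ t in Ioo (0 : ℝ) 1, ‖fderiv ℝ u (x + t • y)‖ₑ * ‖y‖ₑ := by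
  have hmem : ∀ t ∈ Icc (0 : ℝ) 1, x + t • y ∈ upperHalf n :=
    fun t ht => add_smul_mem_upperHalf hx hy ht.1
  have hline : ContDiff ℝ 1 fun t : ℝ => x + t • y := by fun_prop
  have h := enorm_sub_le_lintegral_deriv_of_contDiffOn_Icc
    (f := fun t : ℝ => u (x + t • y)) (hu.comp hline.contDiffOn hmem) zero_le_one
  rw [one_smul, zero_smul, add_zero, enorm_sub_rev, ← restrict_Ioo_eq_restrict_Icc] at h
  refine h.trans (setLIntegral_mono_ae' measurableSet_Ioo (.of_forall fun t ht => ?_))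
  have hdiff : DifferentiableAt ℝ u (x + t • y) :=
    (hu.differentiableOn one_ne_zero).differentiableAt
      ((isOpen_upperHalf n).mem_nhds (hmem t ⟨ht.1.le, ht.2.le⟩))
  have hderiv : HasDerivAt (fun t : ℝ => x + t • y) y t := by
    simpa using ((hasDerivAt_id t).smul_const y).const_add x
  have hcomp : HasDerivAt (fun t : ℝ => u (x + t • y)) (fderiv ℝ u (x + t • y) y) t :=
    hdiff.hasFDerivAt.comp_hasDerivAt t hderiv
  rw [hcomp.deriv]
  exact (fderiv ℝ u (x + t • y)).le_opENorm y

/-- Averaging the fundamental theorem of calculus along rays over a cone. -/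
lemma setLIntegral_enorm_sub_le {n : ℕ} (hn : 1 ≤ n) {u : EuclideanSpace ℝ (Fin n) → ℝ}
    (hu : ContDiffOn ℝ 1 u (upperHalf n)) {R : ℝ} {x : EuclideanSpace ℝ (Fin n)}
    (hx : x ∈ upperHalf n) :
    ∫⁻ z in cone n R x, ‖u x - u z‖ₑ ≤
      ENNReal.ofReal (2 * R) *
        ∫⁻ t in Ioo (0 : ℝ) 1, ∫⁻ y in cone n R 0, ‖fderiv ℝ u (x + t • y)‖ₑ := by
  have hmeas : Measurable (fun q : EuclideanSpace ℝ (Fin n) × ℝ =>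
      ‖fderiv ℝ u (x + q.2 • q.1)‖ₑ) :=
    ((measurable_fderiv ℝ u).comp (by fun_prop)).enorm
  rw [setLIntegral_cone_eq,
    lintegral_lintegral_swap (f := fun (t : ℝ) y => ‖fderiv ℝ u (x + t • y)‖ₑ)
      (hmeas.comp measurable_swap).aemeasurable,
    ← lintegral_const_mul _ hmeas.lintegral_prod_right']
  refine setLIntegral_mono_ae' (measurableSet_cone n R 0) (.of_forall fun y hy => ?_)
  refine (enorm_sub_le_lintegral_enorm_fderiv hu hx hy).trans ?_
  rw [lintegral_mul_const' _ _ enorm_ne_top, mul_comm]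
  gcongr
  rw [← ofReal_norm]
  exact ENNReal.ofReal_le_ofReal
    ((norm_le_two_mul_lastCoord hn hy).trans (by linarith [(mem_cone_zero.1 hy).2]))

lemma rpow_neg_le_of_weight {X Y R t γ p : ℝ} (hX : 0 < X) (hY : 0 < Y) (hYR : Y < R)
    (ht : 0 < t) (ht1 : t < 1) (hp : 0 < p) :
    (X + t * Y) ^ (-γ / p) ≤
      2 ^ (|γ| / p) * t ^ (-(max γ 0 / p)) * max X R ^ (-γ / p) * (Y / R) ^ (-(max γ 0 / p)) := by
  have hR : 0 < R := hY.trans hYR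
  have hM : 0 < max X R := lt_max_of_lt_left hX
  have hYR' : 0 < Y / R := by positivity
  rcases le_total 0 γ with hγ | hγ
  · rw [max_eq_left hγ, neg_div, mul_assoc, mul_assoc, ← Real.mul_rpow hM.le hYR'.le,
      ← Real.mul_rpow ht.le (by positivity)]
    have hle : t * (max X R * (Y / R)) ≤ X + t * Y := by
      rcases le_total X R with h | h
      · rw [max_eq_right h, mul_div_cancel₀ _ hR.ne']
        linarith
      · rw [max_eq_left h]
        have h1 : X * (Y / R) ≤ X := mul_le_of_le_one_right hX.le ((div_le_one hR).2 hYR.le)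
        nlinarith [mul_pos hX hYR']
    calc (X + t * Y) ^ (-(γ / p)) ≤ (t * (max X R * (Y / R))) ^ (-(γ / p)) :=
          Real.rpow_le_rpow_of_nonpos (by positivity) hle (by simpa using by positivity)
      _ ≤ 2 ^ (|γ| / p) * (t * (max X R * (Y / R))) ^ (-(γ / p)) :=
          le_mul_of_one_le_left (by positivity)
            (Real.one_le_rpow one_le_two (by positivity))
  · rw [max_eq_right hγ, abs_of_nonpos hγ]
    simp only [zero_div, neg_zero, Real.rpow_zero, mul_one]
    rw [← Real.mul_rpow zero_le_two hM.le]
    refine Real.rpow_le_rpow (by positivity) ?_ (div_nonneg (by linarith) hp.le)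
    nlinarith [le_max_left X R, le_max_right X R]

/-- Weighted Hölder inequality on the dilated cone `x + t • cone n R 0`. -/
lemma setLIntegral_enorm_fderiv_smul_le {n : ℕ} {p q γ : ℝ} (hpq : p.HolderConjugate q)
    (u : EuclideanSpace ℝ (Fin n) → ℝ) {R t : ℝ} {x : EuclideanSpace ℝ (Fin n)} (hR : 0 < R)
    (hx : x ∈ upperHalf n) (ht : 0 < t) (ht1 : t < 1) :
    ∫⁻ y in cone n R 0, ‖fderiv ℝ u (x + t • y)‖ₑ ≤
      ENNReal.ofReal (2 ^ (|γ| / p) * max (lastCoord n x) R ^ (-γ / p) * (R ^ (n : ℝ)) ^ (1 / q)) *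
        (∫⁻ y in cone n 1 0, ENNReal.ofReal (lastCoord n y ^ (-(max γ 0 / p * q)))) ^ (1 / q) *
        (∫⁻ z in cone n R x,
          ENNReal.ofReal (‖fderiv ℝ u z‖ ^ p * lastCoord n z ^ γ)) ^ (1 / p) *
        ENNReal.ofReal (t ^ (-((n + max γ 0) / p))) := by
  have hp : 0 < p := hpq.pos
  have hq : 0 < q := hpq.symm.pos
  have hx' : 0 < lastCoord n x := hx
  have hM : 0 < max (lastCoord n x) R := lt_max_of_lt_left hx'
  set β : ℝ := max γ 0
  have hlast := (continuous_lastCoord n).measurable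
  have hline : Measurable fun y : EuclideanSpace ℝ (Fin n) => x + t • y := by fun_prop
  let F : EuclideanSpace ℝ (Fin n) → ℝ≥0∞ := fun z =>
    ENNReal.ofReal (‖fderiv ℝ u z‖ * lastCoord n z ^ (γ / p))
  let G : EuclideanSpace ℝ (Fin n) → ℝ≥0∞ := fun y =>
    ENNReal.ofReal ((lastCoord n y / R) ^ (-(β / p)))
  have hF : Measurable F :=
    ((measurable_fderiv ℝ u).norm.mul (hlast.pow_const _)).ennreal_ofReal
  have hG : Measurable G := ((hlast.div_const R).pow_const _).ennreal_ofReal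
  have hpoint : ∀ y ∈ cone n R 0, ‖fderiv ℝ u (x + t • y)‖ₑ ≤
      ENNReal.ofReal (2 ^ (|γ| / p) * t ^ (-(β / p)) * max (lastCoord n x) R ^ (-γ / p)) *
        (F (x + t • y) * G y) := by
    intro y hy
    have hy0 := lastCoord_pos_of_mem_cone_zero hy
    have hz : 0 < lastCoord n (x + t • y) := add_smul_mem_upperHalf hx hy ht.le
    have hw := rpow_neg_le_of_weight (γ := γ) hx' hy0 (mem_cone_zero.1 hy).2 ht ht1 hp
    rw [← lastCoord_smul, ← lastCoord_add] at hw
    rw [← ofReal_norm, ← ENNReal.ofReal_mul (by positivity), ← ENNReal.ofReal_mul (by positivity)]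
    refine ENNReal.ofReal_le_ofReal ?_
    calc ‖fderiv ℝ u (x + t • y)‖
        = ‖fderiv ℝ u (x + t • y)‖ * lastCoord n (x + t • y) ^ (γ / p) *
            lastCoord n (x + t • y) ^ (-γ / p) := by
          rw [mul_assoc, ← Real.rpow_add hz, neg_div, add_neg_cancel, Real.rpow_zero, mul_one]
      _ ≤ _ := mul_le_mul_of_nonneg_left hw (by positivity)
      _ = _ := by ring
  have hFp : (∫⁻ y in cone n R 0, F (x + t • y) ^ p) ≤ ENNReal.ofReal (t ^ (-(n : ℝ))) *
      ∫⁻ z in cone n R x, ENNReal.ofReal (‖fderiv ℝ u z‖ ^ p * lastCoord n z ^ γ) := by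
    rw [setLIntegral_cone_comp_smul n ht R (fun w => F (x + w) ^ p), setLIntegral_cone_eq n R x]
    refine mul_le_mul_right ?_ _
    refine (lintegral_mono_set (cone_mono n (mul_le_of_le_one_left hR.le ht1.le) 0)).trans ?_
    refine setLIntegral_mono_ae' (measurableSet_cone n R 0) (.of_forall fun y hy => le_of_eq ?_)
    have hz : 0 < lastCoord n (x + y) := by
      have h := add_smul_mem_upperHalf hx hy zero_le_one
      rwa [one_smul] at h
    rw [ENNReal.ofReal_rpow_of_nonneg (by positivity) hp.le,
      Real.mul_rpow (norm_nonneg _) (by positivity), ← Real.rpow_mul hz.le, div_mul_cancel₀ _ hp.ne']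
  have hGq : (∫⁻ y in cone n R 0, G y ^ q) = ENNReal.ofReal (R ^ (n : ℝ)) *
      ∫⁻ y in cone n 1 0, ENNReal.ofReal (lastCoord n y ^ (-(β / p * q))) := by
    rw [← setLIntegral_cone_div_rpow n hR]
    refine setLIntegral_congr_fun (measurableSet_cone n R 0) fun y hy => ?_
    have hy0 := lastCoord_pos_of_mem_cone_zero hy
    simp only [G]
    rw [ENNReal.ofReal_rpow_of_nonneg (by positivity) hq.le, ← Real.rpow_mul (by positivity),
      neg_mul]
  have hHolder := ENNReal.lintegral_mul_le_Lp_mul_Lq (volume.restrict (cone n R 0)) hpq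
    (hF.comp hline).aemeasurable hG.aemeasurable
  simp only [Pi.mul_apply, Function.comp_apply] at hHolder
  rw [hGq] at hHolder
  have hexp : t ^ (-((n + β) / p)) = t ^ (-(β / p)) * (t ^ (-(n : ℝ))) ^ (1 / p) := by
    rw [← Real.rpow_mul ht.le, ← Real.rpow_add ht]
    congr 1
    ring
  calc ∫⁻ y in cone n R 0, ‖fderiv ℝ u (x + t • y)‖ₑ
      ≤ ∫⁻ y in cone n R 0,
          ENNReal.ofReal (2 ^ (|γ| / p) * t ^ (-(β / p)) * max (lastCoord n x) R ^ (-γ / p)) *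
            (F (x + t • y) * G y) :=
        setLIntegral_mono_ae' (measurableSet_cone n R 0) (.of_forall hpoint)
    _ = ENNReal.ofReal (2 ^ (|γ| / p) * t ^ (-(β / p)) * max (lastCoord n x) R ^ (-γ / p)) *
          ∫⁻ y in cone n R 0, F (x + t • y) * G y :=
        lintegral_const_mul _ ((hF.comp hline).mul hG)
    _ ≤ _ := mul_le_mul_right (hHolder.trans (mul_le_mul_left
        (ENNReal.rpow_le_rpow hFp (by positivity)) _)) _
    _ = _ := by
        rw [ENNReal.mul_rpow_of_nonneg _ _ (by positivity : 0 ≤ 1 / p),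
          ENNReal.mul_rpow_of_nonneg _ _ (by positivity : 0 ≤ 1 / q),
          ENNReal.ofReal_rpow_of_nonneg (by positivity) (by positivity),
          ENNReal.ofReal_rpow_of_nonneg (by positivity) (by positivity), hexp,
          ENNReal.ofReal_mul (by positivity), ENNReal.ofReal_mul (by positivity),
          ENNReal.ofReal_mul (by positivity), ENNReal.ofReal_mul (by positivity),
          ENNReal.ofReal_mul (by positivity)]
        ring

lemma setLIntegral_Ioo_rpow_lt_top {a : ℝ} (ha : a < 1) :
    ∫⁻ t in Ioo (0 : ℝ) 1, ENNReal.ofReal (t ^ (-a)) < ∞ :=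
  ((intervalIntegral.integrableOn_Ioo_rpow_iff zero_lt_one).2 (by linarith)).lintegral_lt_top

/-- Estimate on cone averages, case `γ < p - n`. -/
theorem cone_average_estimate_lt (n : ℕ) (hn : 1 ≤ n) (p γ : ℝ)
    (hnp : (n : ℝ) < p) (hγ : γ < p - n) :
    ∃ C : ℝ, 0 < C ∧
      ∀ u : EuclideanSpace ℝ (Fin n) → ℝ,
        ContDiffOn ℝ 1 u (upperHalf n) →
        ∀ x ∈ upperHalf n, ∀ R > (0 : ℝ),
          (volume (cone n R x))⁻¹ * (∫⁻ z in cone n R x, ENNReal.ofReal |u x - u z|) ≤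
            ENNReal.ofReal
                (C * max (lastCoord n x) R ^ (-γ / p) * R ^ (1 - (n : ℝ) / p)) *
              (∫⁻ z in cone n R x,
                  ENNReal.ofReal (‖fderiv ℝ u z‖ ^ p * lastCoord n z ^ γ)) ^ (1 / p) := by
  have hn1 : (1 : ℝ) ≤ n := by exact_mod_cast hn
  have hp : 0 < p := by linarith
  have hpq : p.HolderConjugate (p.conjExponent) := .conjExponent (by linarith)
  set q := p.conjExponent with hq
  have hq0 : 0 < q := hpq.symm.pos
  set β : ℝ := max γ 0
  have hβ0 : 0 ≤ β := le_max_right _ _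
  have hβp : β < p - n := max_lt hγ (by linarith)
  set V := volume (cone n 1 0)
  have hV0 : V ≠ 0 := volume_cone_one_ne_zero hn
  have hVtop : V ≠ ∞ := volume_cone_one_ne_top hn
  set K := (∫⁻ y in cone n 1 0, ENNReal.ofReal (lastCoord n y ^ (-(β / p * q)))) ^ (1 / q)
  have hKtop : K ≠ ∞ := by
    refine ENNReal.rpow_ne_top_of_nonneg (by positivity)
      (setLIntegral_cone_one_rpow_lt_top hn (by positivity) ?_).ne
    have hp1 : 0 < p - 1 := by linarith
    rw [hq, Real.conjExponent, div_mul_div_cancel₀ hp.ne', div_lt_iff₀ hp1]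
    nlinarith
  set T := ∫⁻ t in Ioo (0 : ℝ) 1, ENNReal.ofReal (t ^ (-((n + β) / p))) with hT
  have hTtop : T ≠ ∞ :=
    (setLIntegral_Ioo_rpow_lt_top ((div_lt_one hp).2 (by linarith))).ne
  set A := V⁻¹ * ENNReal.ofReal (2 * 2 ^ (|γ| / p)) * K * T
  have hAtop : A ≠ ∞ :=
    ENNReal.mul_ne_top (ENNReal.mul_ne_top
      (ENNReal.mul_ne_top (ENNReal.inv_ne_top.2 hV0) ENNReal.ofReal_ne_top) hKtop) hTtop
  have hAle : A ≤ ENNReal.ofReal (A.toReal + 1) := by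
    rw [ENNReal.le_ofReal_iff_toReal_le hAtop (by positivity)]
    linarith
  refine ⟨A.toReal + 1, by positivity, fun u hu x hx R hR => ?_⟩
  have hM : 0 < max (lastCoord n x) R := lt_max_of_lt_right hR
  set I := (∫⁻ z in cone n R x,
    ENNReal.ofReal (‖fderiv ℝ u z‖ ^ p * lastCoord n z ^ γ)) ^ (1 / p)
  set B := 2 ^ (|γ| / p) * max (lastCoord n x) R ^ (-γ / p) * (R ^ (n : ℝ)) ^ (1 / q) with hB
  have hmeas : Measurable fun t : ℝ => ENNReal.ofReal (t ^ (-((n + β) / p))) := by fun_prop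
  have hmain : ∫⁻ z in cone n R x, ENNReal.ofReal |u x - u z| ≤
      ENNReal.ofReal (2 * R) * (ENNReal.ofReal B * K * I * T) := by
    simp only [← Real.enorm_eq_ofReal_abs]
    refine (setLIntegral_enorm_sub_le hn hu hx).trans (mul_le_mul_right ?_ _)
    rw [hT, ← lintegral_const_mul _ hmeas]
    exact setLIntegral_mono_ae' measurableSet_Ioo (.of_forall fun t ht =>
      setLIntegral_enorm_fderiv_smul_le hpq u hR hx ht.1 ht.2)
  have hvol : (volume (cone n R x))⁻¹ = ENNReal.ofReal (R ^ (-(n : ℝ))) * V⁻¹ := by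
    rw [volume_cone_eq, volume_cone_zero n hR,
      ENNReal.mul_inv (.inr hVtop) (.inl ENNReal.ofReal_ne_top),
      ← ENNReal.ofReal_inv_of_pos (by positivity), Real.rpow_neg hR.le]
  have hscale : R ^ (-(n : ℝ)) * (2 * R) * B =
      2 * 2 ^ (|γ| / p) * (max (lastCoord n x) R ^ (-γ / p) * R ^ (1 - (n : ℝ) / p)) := by
    have hexp : R ^ (1 - (n : ℝ) / p) = R ^ (-(n : ℝ)) * R * (R ^ (n : ℝ)) ^ (1 / q) := by
      have hq' : 1 / q = 1 - 1 / p := by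
        rw [one_div, one_div, ← hpq.one_sub_inv]
      rw [← Real.rpow_mul hR.le, ← Real.rpow_add_one hR.ne', ← Real.rpow_add hR, hq']
      congr 1
      ring
    rw [hexp, hB]
    ring
  calc (volume (cone n R x))⁻¹ * ∫⁻ z in cone n R x, ENNReal.ofReal |u x - u z|
      ≤ ENNReal.ofReal (R ^ (-(n : ℝ))) * V⁻¹ *
          (ENNReal.ofReal (2 * R) * (ENNReal.ofReal B * K * I * T)) := by
        rw [hvol]
        exact mul_le_mul_right hmain _
    _ = V⁻¹ * ENNReal.ofReal (R ^ (-(n : ℝ)) * (2 * R) * B) * K * T * I := by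
        rw [ENNReal.ofReal_mul (p := R ^ (-(n : ℝ)) * (2 * R)) (by positivity),
          ENNReal.ofReal_mul (p := R ^ (-(n : ℝ))) (by positivity)]
        ring
    _ = A * ENNReal.ofReal (max (lastCoord n x) R ^ (-γ / p) * R ^ (1 - (n : ℝ) / p)) * I := by
        rw [hscale, ENNReal.ofReal_mul (by positivity)]
        ring
    _ ≤ _ := by
        rw [mul_assoc (A.toReal + 1), ENNReal.ofReal_mul (by positivity : 0 ≤ A.toReal + 1)]
        gcongr
end
end

section
/- Let n ≥ 1, n < p < +∞, and γ ∈ ℝ with γ < p − 1. There exists a constant C > 0, depending only on n, γ and p, such that every u ∈ C_c^∞(ℝⁿ₊) satisfies, for all x ∈ ℝⁿ₊, |u(x)| ≤ C · xₙ^{1 − (n+γ)/p} · E_γ(u)^{1/p}. -/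
open MeasureTheory Real Set
open scoped ENNReal

noncomputable section

/-- Affine change of variables `v ↦ x - t • v` in a Lebesgue integral. -/
lemma lintegral_comp_sub_smul {E : Type*} [NormedAddCommGroup E] [NormedSpace ℝ E]
    [FiniteDimensional ℝ E] [MeasurableSpace E] [BorelSpace E] (μ : Measure E)
    [μ.IsAddHaarMeasure] {f : E → ℝ≥0∞} (hf : Measurable f) (x : E) {t : ℝ} (ht : 0 < t) :
    ∫⁻ v, f (x - t • v) ∂μ = ENNReal.ofReal ((t ^ Module.finrank ℝ E)⁻¹) * ∫⁻ z, f z ∂μ := by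
  have h1 : ∫⁻ v, f (x - t • v) ∂μ = ∫⁻ y, f (x - y) ∂(Measure.map (fun v => t • v) μ) := by
    rw [lintegral_map (by fun_prop) (by fun_prop)]
  rw [h1, Measure.map_addHaar_smul μ ht.ne', lintegral_smul_measure, lintegral_sub_left_eq_self,
    abs_of_pos (by positivity), smul_eq_mul]

lemma setLIntegral_Ioc_rpow {b X : ℝ} (hb : -1 < b) (hX : 0 ≤ X) :
    ∫⁻ r in Ioc 0 X, ENNReal.ofReal (r ^ b) = ENNReal.ofReal (X ^ (b + 1) / (b + 1)) := by
  have hi := (intervalIntegral.intervalIntegrable_rpow' (a := 0) (b := X) hb)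
  rw [intervalIntegrable_iff_integrableOn_Ioc_of_le hX] at hi
  rw [← ofReal_integral_eq_lintegral_ofReal hi, ← intervalIntegral.integral_of_le hX,
    integral_rpow (Or.inl hb), Real.zero_rpow (by linarith), sub_zero]
  filter_upwards [ae_restrict_mem measurableSet_Ioc] with r hr
  exact Real.rpow_nonneg hr.1.le b

/-- The positive part of the power function `r ↦ r ^ b`, with values in `[0, ∞]`. -/
def posRpow (b : ℝ) : ℝ → ℝ≥0∞ := (Ioi 0).indicator fun r => ENNReal.ofReal (r ^ b)

lemma measurable_posRpow (b : ℝ) : Measurable (posRpow b) :=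
  Measurable.indicator (by fun_prop) measurableSet_Ioi

lemma rpow_le_of_mem_Icc_half {b r X : ℝ} (hX : 0 < X) (h1 : X / 2 ≤ r) (h2 : r ≤ X) :
    r ^ b ≤ (1 + 2 ^ (-b)) * X ^ b := by
  have hXb : 0 < X ^ b := Real.rpow_pos_of_pos hX b
  have h2b : (0 : ℝ) < 2 ^ (-b) := Real.rpow_pos_of_pos two_pos _
  rcases le_total 0 b with hb | hb
  · nlinarith [Real.rpow_le_rpow (by linarith) h2 hb]
  · have h3 := Real.rpow_le_rpow_of_nonpos (by positivity : 0 < X / 2) h1 hb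
    rw [Real.div_rpow hX.le two_pos.le, div_eq_mul_inv, ← Real.rpow_neg two_pos.le] at h3
    nlinarith

lemma setLIntegral_posRpow_le {b X t : ℝ} (hb : -1 < b) (ht : 0 < t) (htX : t ≤ X) :
    ∫⁻ s in Ioo 1 2, posRpow b (X - t * s) ≤
      ENNReal.ofReal ((1 + 2 ^ (-b) + 4 / (b + 1)) * X ^ b) := by
  have hX : 0 < X := ht.trans_le htX
  have hXb : 0 < X ^ b := Real.rpow_pos_of_pos hX b
  have h2b : (0 : ℝ) < 2 ^ (-b) := Real.rpow_pos_of_pos two_pos _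
  have hb1 : 0 < b + 1 := by linarith
  have hq : 0 < 4 / (b + 1) := by positivity
  rcases le_or_gt t (X / 4) with h | h
  · calc ∫⁻ s in Ioo 1 2, posRpow b (X - t * s)
        ≤ ∫⁻ s in Ioo (1 : ℝ) 2, ENNReal.ofReal ((1 + 2 ^ (-b)) * X ^ b) := by
          refine setLIntegral_mono' measurableSet_Ioo fun s hs => ?_
          have h1 : X / 2 ≤ X - t * s := by nlinarith [hs.2]
          have h2 : X - t * s ≤ X := by nlinarith [hs.1]
          rw [posRpow, indicator_of_mem (mem_Ioi.2 (by linarith))]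
          exact ENNReal.ofReal_le_ofReal (rpow_le_of_mem_Icc_half hX h1 h2)
      _ = ENNReal.ofReal ((1 + 2 ^ (-b)) * X ^ b) := by
          rw [setLIntegral_const, Real.volume_Ioo]; norm_num
      _ ≤ _ := ENNReal.ofReal_le_ofReal (by nlinarith)
  · calc ∫⁻ s in Ioo 1 2, posRpow b (X - t * s)
        ≤ ∫⁻ s in Ioo (1 : ℝ) 2,
            (Ioc 0 X).indicator (fun r => ENNReal.ofReal (r ^ b)) (X - t • s) := by
          refine setLIntegral_mono' measurableSet_Ioo fun s hs => ?_
          rw [smul_eq_mul, posRpow]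
          by_cases h0 : 0 < X - t * s
          · rw [indicator_of_mem (mem_Ioi.2 h0),
              indicator_of_mem (mem_Ioc.2 ⟨h0, by nlinarith [hs.1]⟩)]
          · rw [indicator_of_notMem (by simpa using h0)]
            exact zero_le
      _ ≤ ∫⁻ s, (Ioc 0 X).indicator (fun r => ENNReal.ofReal (r ^ b)) (X - t • s) :=
          setLIntegral_le_lintegral _ _
      _ = ENNReal.ofReal t⁻¹ * ENNReal.ofReal (X ^ (b + 1) / (b + 1)) := by
          rw [lintegral_comp_sub_smul volume
            (Measurable.indicator (by fun_prop) measurableSet_Ioc) X ht,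
            lintegral_indicator measurableSet_Ioc, setLIntegral_Ioc_rpow hb hX.le]
          simp
      _ ≤ _ := by
          rw [← ENNReal.ofReal_mul (by positivity)]
          refine ENNReal.ofReal_le_ofReal ?_
          have h4 : t⁻¹ ≤ 4 / X := by
            rw [inv_le_comm₀ ht (by positivity), inv_div]; exact h.le
          calc t⁻¹ * (X ^ (b + 1) / (b + 1)) ≤ 4 / X * (X ^ (b + 1) / (b + 1)) := by gcongr
            _ = 4 / (b + 1) * X ^ b := by
              rw [Real.rpow_add_one hX.ne']; field_simp
            _ ≤ _ := by nlinarith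

/-- The open cube `(1, 2)^ι`. -/
def openCube (ι : Type*) : Set (EuclideanSpace ℝ ι) := {v | ∀ i, v i ∈ Ioo (1 : ℝ) 2}

lemma measurableSet_openCube {ι : Type*} [Fintype ι] : MeasurableSet (openCube ι) := by
  have : openCube ι = ⋂ i, (fun v : EuclideanSpace ℝ ι => v i) ⁻¹' Ioo (1 : ℝ) 2 := by
    ext v; simp [openCube]
  rw [this]
  exact MeasurableSet.iInter fun i => measurableSet_Ioo.preimage (by fun_prop)

lemma measurePreserving_coord_openCube {ι : Type*} [Fintype ι] (i : ι) :
    MeasurePreserving (fun v : EuclideanSpace ℝ ι => v i) (volume.restrict (openCube ι))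
      (volume.restrict (Ioo (1 : ℝ) 2)) := by
  have : IsProbabilityMeasure (volume.restrict (Ioo (1 : ℝ) 2)) :=
    ⟨by rw [Measure.restrict_apply_univ, Real.volume_Ioo]; norm_num⟩
  have h1 := measurePreserving_eval (fun _ : ι => volume.restrict (Ioo (1 : ℝ) 2)) i
  rw [← Measure.restrict_pi_pi] at h1
  have h2 := (EuclideanSpace.volume_preserving_symm_measurableEquiv_toLp ι).restrict_preimage
    (s := univ.pi fun _ => Ioo (1 : ℝ) 2)
    (MeasurableSet.univ_pi fun _ => measurableSet_Ioo)
  have h3 := h1.comp h2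
  have h4 : openCube ι = (MeasurableEquiv.toLp 2 (ι → ℝ)).symm ⁻¹'
      univ.pi fun _ => Ioo (1 : ℝ) 2 := by
    ext v
    simp only [openCube, mem_preimage, mem_univ_pi, mem_ofPred_eq]
    rfl
  rw [h4]
  exact h3

lemma norm_le_of_mem_openCube {ι : Type*} [Fintype ι] {v : EuclideanSpace ℝ ι}
    (hv : v ∈ openCube ι) :
    ‖v‖ ≤ 2 * √(Fintype.card ι) := by
  rw [EuclideanSpace.norm_eq]
  refine Real.sqrt_le_iff.2 ⟨by positivity, ?_⟩
  rw [mul_pow, Real.sq_sqrt (by positivity)]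
  calc ∑ i, ‖v i‖ ^ 2 ≤ ∑ _i : ι, (2 : ℝ) ^ 2 := by
        refine Finset.sum_le_sum fun i _ => ?_
        rw [Real.norm_of_nonneg (by linarith [(hv i).1])]
        have := hv i
        exact pow_le_pow_left₀ (by linarith [this.1]) this.2.le 2
    _ = _ := by simp; ring

/-- Fundamental theorem of calculus along a segment at whose far end `u` vanishes. -/
lemma enorm_le_lintegral_enorm_fderiv {E : Type*} [NormedAddCommGroup E] [NormedSpace ℝ E]
    {u : E → ℝ} (hu : ContDiff ℝ 1 u) (x v : E) {T : ℝ} (hT : 0 ≤ T) (h0 : u (x - T • v) = 0) :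
    ‖u x‖ₑ ≤ ‖v‖ₑ * ∫⁻ t in Ioc 0 T, ‖fderiv ℝ u (x - t • v)‖ₑ := by
  have hc : Continuous fun t : ℝ => fderiv ℝ u (x - t • v) (-v) := by
    have := hu.continuous_fderiv one_ne_zero
    fun_prop
  have hd (t : ℝ) : HasDerivAt (fun t : ℝ => u (x - t • v)) (fderiv ℝ u (x - t • v) (-v)) t := by
    have h1 := (hu.differentiable one_ne_zero (x - t • v)).hasFDerivAt
    have h2 : HasDerivAt (fun t : ℝ => x - t • v) (-v) t := by
      simpa using ((hasDerivAt_id t).smul_const v).const_sub x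
    exact h1.comp_hasDerivAt t h2
  have hftc := intervalIntegral.integral_eq_sub_of_hasDerivAt (fun t _ => hd t)
    (hc.intervalIntegrable 0 T)
  rw [h0, zero_smul, sub_zero, zero_sub, intervalIntegral.integral_of_le hT] at hftc
  rw [← enorm_neg, ← hftc, ← lintegral_const_mul' _ _ enorm_ne_top]
  refine (enorm_integral_le_lintegral_enorm _).trans (lintegral_mono fun t => ?_)
  rw [mul_comm, ← enorm_neg v]
  exact ContinuousLinearMap.le_opENorm _ _

/-- The density `‖Du(z)‖ ^ p * zᵢ ^ γ`, extended by zero outside the half-space `zᵢ > 0`. -/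
def energyDensity {ι : Type*} [Fintype ι] (i : ι) (γ p : ℝ) (u : EuclideanSpace ℝ ι → ℝ) :
    EuclideanSpace ℝ ι → ℝ≥0∞ :=
  {z | 0 < z i}.indicator fun z => ENNReal.ofReal (‖fderiv ℝ u z‖ ^ p * z i ^ γ)

lemma measurableSet_coord_pos {ι : Type*} [Fintype ι] (i : ι) :
    MeasurableSet {z : EuclideanSpace ℝ ι | 0 < z i} :=
  measurableSet_lt (by fun_prop) (by fun_prop)

lemma measurable_energyDensity {ι : Type*} [Fintype ι] (i : ι) (γ p : ℝ)
    {u : EuclideanSpace ℝ ι → ℝ} (hu : ContDiff ℝ 1 u) : Measurable (energyDensity i γ p u) := by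
  have h1 : Measurable (fderiv ℝ u) := (hu.continuous_fderiv one_ne_zero).measurable
  refine Measurable.indicator ?_ (measurableSet_coord_pos i)
  fun_prop

lemma enorm_fderiv_le_mul {ι : Type*} [Fintype ι] (i : ι) {γ p : ℝ} (hp : 1 < p)
    {u : EuclideanSpace ℝ ι → ℝ} {z : EuclideanSpace ℝ ι} (hz : 0 < z i ∨ fderiv ℝ u z = 0) :
    ‖fderiv ℝ u z‖ₑ ≤ energyDensity i γ p u z ^ (1 / p) *
      posRpow (-(γ / (p - 1))) (z i) ^ ((p - 1) / p) := by
  have hp0 : 0 < p := by linarith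
  by_cases h : 0 < z i
  · rw [energyDensity, posRpow, indicator_of_mem (mem_Ioi.2 h),
      indicator_of_mem (show z ∈ {z : EuclideanSpace ℝ ι | 0 < z i} from h),
      ENNReal.ofReal_rpow_of_nonneg (by positivity) (by positivity),
      ENNReal.ofReal_rpow_of_pos (by positivity), ← ENNReal.ofReal_mul (by positivity),
      ← ofReal_norm]
    refine ENNReal.ofReal_le_ofReal (le_of_eq ?_)
    rw [Real.mul_rpow (by positivity) (by positivity), ← Real.rpow_mul (norm_nonneg _),
      ← Real.rpow_mul h.le, ← Real.rpow_mul h.le, mul_assoc, ← Real.rpow_add h]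
    have hp1 : p - 1 ≠ 0 := by linarith
    have e1 : γ * (1 / p) + -(γ / (p - 1)) * ((p - 1) / p) = 0 := by field_simp; ring
    rw [e1, mul_one_div_cancel hp0.ne']
    simp
  · rw [← ofReal_norm, hz.resolve_left h, norm_zero, ENNReal.ofReal_zero]
    exact zero_le

/-- Hölder inequality on one slice of the cone with vertex `x`. -/
lemma setLIntegral_openCube_enorm_fderiv_le {ι : Type*} [Fintype ι] (i : ι) {γ p : ℝ} (hp : 1 < p)
    (hγ : γ < p - 1) {u : EuclideanSpace ℝ ι → ℝ} (hu : ContDiff ℝ 1 u)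
    (hz : ∀ z, 0 < z i ∨ fderiv ℝ u z = 0) (x : EuclideanSpace ℝ ι) {t : ℝ} (ht : 0 < t)
    (htx : t ≤ x i) :
    ∫⁻ v in openCube ι, ‖fderiv ℝ u (x - t • v)‖ₑ ≤
      (ENNReal.ofReal ((t ^ Fintype.card ι)⁻¹) * ∫⁻ z, energyDensity i γ p u z) ^ (1 / p) *
      ENNReal.ofReal ((1 + 2 ^ (γ / (p - 1)) + 4 / (1 - γ / (p - 1))) * x i ^ (-(γ / (p - 1))))
        ^ ((p - 1) / p) := by
  have hp0 : 0 < p := by linarith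
  have hp1 : 0 < p - 1 := by linarith
  have hconj : p.HolderConjugate (p / (p - 1)) := Real.HolderConjugate.conjExponent hp
  have hG := measurable_energyDensity i γ p hu
  have hW := measurable_posRpow (-(γ / (p - 1)))
  have hb : -1 < -(γ / (p - 1)) := by
    rw [neg_lt_neg_iff, div_lt_one hp1]; exact hγ
  calc ∫⁻ v in openCube ι, ‖fderiv ℝ u (x - t • v)‖ₑ
      ≤ ∫⁻ v in openCube ι, ((fun v => energyDensity i γ p u (x - t • v) ^ (1 / p)) *
          fun v : EuclideanSpace ℝ ι => posRpow (-(γ / (p - 1))) (x i - t * v i) ^ ((p - 1) / p)) v :=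
        lintegral_mono fun v => enorm_fderiv_le_mul i hp (hz _)
    _ ≤ (∫⁻ v in openCube ι, (energyDensity i γ p u (x - t • v) ^ (1 / p)) ^ p) ^ (1 / p) *
        (∫⁻ v in openCube ι, (posRpow (-(γ / (p - 1))) (x i - t * v i) ^ ((p - 1) / p))
          ^ (p / (p - 1))) ^ (1 / (p / (p - 1))) :=
        ENNReal.lintegral_mul_le_Lp_mul_Lq _ hconj (by fun_prop) (by fun_prop)
    _ = (∫⁻ v in openCube ι, energyDensity i γ p u (x - t • v)) ^ (1 / p) *
        (∫⁻ v in openCube ι, posRpow (-(γ / (p - 1))) (x i - t * v i)) ^ ((p - 1) / p) := by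
        simp_rw [← ENNReal.rpow_mul, one_div_div]
        rw [one_div_mul_cancel hp0.ne', div_mul_div_cancel₀ hp0.ne', div_self hp1.ne']
        simp_rw [ENNReal.rpow_one]
    _ ≤ _ := by
        gcongr
        · refine (setLIntegral_le_lintegral _ _).trans (le_of_eq ?_)
          rw [lintegral_comp_sub_smul volume hG x ht, finrank_euclideanSpace]
        · have := (measurePreserving_coord_openCube i).lintegral_comp
            (f := fun s => posRpow (-(γ / (p - 1))) (x i - t * s)) (by fun_prop)
          rw [this]
          refine (setLIntegral_posRpow_le hb ht htx).trans (le_of_eq ?_)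
          rw [neg_neg, neg_add_eq_sub]

lemma enorm_le_of_forall_fderiv_eq_zero {ι : Type*} [Fintype ι] (i : ι) {γ p : ℝ} (hp : 1 < p)
    (hcard : Fintype.card ι < p) (hγ : γ < p - 1) {u : EuclideanSpace ℝ ι → ℝ}
    (hu : ContDiff ℝ 1 u) (h0 : ∀ z, 0 < z i ∨ u z = 0) (hz : ∀ z, 0 < z i ∨ fderiv ℝ u z = 0)
    (x : EuclideanSpace ℝ ι) (hx : 0 < x i) :
    ‖u x‖ₑ ≤ ENNReal.ofReal (2 * √(Fintype.card ι)) *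
      (ENNReal.ofReal (x i ^ (-(Fintype.card ι / p) + 1) / (-(Fintype.card ι / p) + 1)) *
      ((∫⁻ z, energyDensity i γ p u z) ^ (1 / p) *
      ENNReal.ofReal ((1 + 2 ^ (γ / (p - 1)) + 4 / (1 - γ / (p - 1))) * x i ^ (-(γ / (p - 1))))
        ^ ((p - 1) / p))) := by
  have hp0 : 0 < p := by linarith
  have hvol : volume.restrict (openCube ι) univ = 1 := by
    rw [← preimage_univ (f := fun v : EuclideanSpace ℝ ι => v i),
      (measurePreserving_coord_openCube i).measure_preimage nullMeasurableSet_univ,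
      Measure.restrict_apply_univ, Real.volume_Ioo]
    norm_num
  have hDu : Continuous (fderiv ℝ u) := hu.continuous_fderiv one_ne_zero
  calc ‖u x‖ₑ = ∫⁻ _v in openCube ι, ‖u x‖ₑ := by rw [lintegral_const, hvol, mul_one]
    _ ≤ ∫⁻ v in openCube ι, ENNReal.ofReal (2 * √(Fintype.card ι)) *
          ∫⁻ t in Ioc 0 (x i), ‖fderiv ℝ u (x - t • v)‖ₑ := by
        refine setLIntegral_mono' measurableSet_openCube fun v hv => ?_
        refine (enorm_le_lintegral_enorm_fderiv hu x v hx.le ((h0 _).resolve_left ?_)).trans ?_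
        · have := (hv i).1
          simp only [PiLp.sub_apply, PiLp.smul_apply, smul_eq_mul, not_lt]
          nlinarith
        · gcongr
          rw [← ofReal_norm]
          exact ENNReal.ofReal_le_ofReal (norm_le_of_mem_openCube hv)
    _ = ENNReal.ofReal (2 * √(Fintype.card ι)) *
          ∫⁻ t in Ioc 0 (x i), ∫⁻ v in openCube ι, ‖fderiv ℝ u (x - t • v)‖ₑ := by
        rw [lintegral_const_mul' _ _ ENNReal.ofReal_ne_top, lintegral_lintegral_swap]
        refine (Continuous.measurable ?_).aemeasurable
        unfold Function.uncurry
        fun_prop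
    _ ≤ ENNReal.ofReal (2 * √(Fintype.card ι)) * ∫⁻ t in Ioc 0 (x i),
          ENNReal.ofReal (t ^ (-(Fintype.card ι / p))) *
          ((∫⁻ z, energyDensity i γ p u z) ^ (1 / p) * ENNReal.ofReal
            ((1 + 2 ^ (γ / (p - 1)) + 4 / (1 - γ / (p - 1))) * x i ^ (-(γ / (p - 1))))
            ^ ((p - 1) / p)) := by
        refine mul_le_mul_right ?_ _
        refine setLIntegral_mono' measurableSet_Ioc fun t (ht : t ∈ Ioc 0 (x i)) => ?_
        refine (setLIntegral_openCube_enorm_fderiv_le i hp hγ hu hz x ht.1 ht.2).trans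
          (le_of_eq ?_)
        have ht0 := ht.1
        rw [ENNReal.mul_rpow_of_nonneg _ _ (by positivity), mul_assoc,
          ENNReal.ofReal_rpow_of_nonneg (by positivity) (by positivity), ← Real.rpow_natCast,
          ← Real.rpow_neg ht0.le, ← Real.rpow_mul ht0.le, neg_mul, mul_one_div]
    _ = _ := by
        rw [lintegral_mul_const _ (by fun_prop), setLIntegral_Ioc_rpow _ hx.le]
        rw [neg_lt_neg_iff, div_lt_one hp0]
        exact hcard

lemma lintegral_energyDensity_ne_top {ι : Type*} [Fintype ι] (i : ι) {γ p : ℝ} (hp : 0 < p)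
    {u : EuclideanSpace ℝ ι → ℝ} (hu : ContDiff ℝ 1 u) (hc : HasCompactSupport u)
    (hs : tsupport u ⊆ {z | 0 < z i}) : ∫⁻ z, energyDensity i γ p u z ≠ ∞ := by
  have hDu : Continuous (fderiv ℝ u) := hu.continuous_fderiv one_ne_zero
  have hcont : ContinuousOn (fun z => ‖fderiv ℝ u z‖ ^ p * z i ^ γ) (tsupport u) := by
    refine ContinuousOn.mul ?_ ?_
    · exact (hDu.norm.rpow_const fun _ => Or.inr hp.le).continuousOn
    · exact ContinuousOn.rpow_const (by fun_prop) fun z hz => Or.inl (hs hz).ne'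
  have hint := (hcont.integrableOn_compact (μ := volume) hc).lintegral_lt_top
  refine (lt_of_le_of_lt ?_ hint).ne
  rw [← lintegral_indicator (isClosed_tsupport u).measurableSet]
  refine lintegral_mono fun z => ?_
  by_cases hz : z ∈ tsupport u
  · rw [indicator_of_mem hz, energyDensity]
    exact indicator_le_self _ _ z
  · have : fderiv ℝ u z = 0 := image_eq_zero_of_notMem_tsupport
      fun h => hz (tsupport_fderiv_subset ℝ h)
    simp [Real.zero_rpow hp.ne', energyDensity, indicator, this]

/-- Pointwise estimate for compactly supported functions in terms of the distance to the
boundary. -/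
theorem compact_support_pointwise_estimate (n : ℕ) (hn : 1 ≤ n) (p γ : ℝ)
    (hnp : (n : ℝ) < p) (hγ : γ < p - 1) :
    ∃ C : ℝ, 0 < C ∧
      ∀ u : EuclideanSpace ℝ (Fin n) → ℝ,
        ContDiff ℝ (⊤ : ℕ∞) u → HasCompactSupport u → tsupport u ⊆ upperHalf n →
        ∀ x ∈ upperHalf n,
          |u x| ≤ C * lastCoord n x ^ (1 - ((n : ℝ) + γ) / p) *
            (energy n γ p u).toReal ^ (1 / p) := by

  obtain ⟨i, hi⟩ : ∃ i : Fin n, ∀ z, lastCoord n z = z i :=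
    ⟨⟨n - 1, Nat.sub_lt hn one_pos⟩, fun z => dif_pos hn⟩
  have hn1 : (1 : ℝ) ≤ n := by exact_mod_cast hn
  have hp : 1 < p := by linarith
  have hp0 : 0 < p := by linarith
  have hp1 : 0 < p - 1 := by linarith
  have hγ1 : 0 < 1 - γ / (p - 1) := by rw [sub_pos, div_lt_one hp1]; exact hγ
  have hnp1 : 0 < -((n : ℝ) / p) + 1 := by
    rw [neg_add_eq_sub, sub_pos, div_lt_one hp0]; exact hnp
  have hH : upperHalf n = {z | 0 < z i} := by ext z; simp [upperHalf, hi]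
  set K : ℝ := 1 + 2 ^ (γ / (p - 1)) + 4 / (1 - γ / (p - 1)) with hK
  have hK0 : 0 < K := by positivity
  refine ⟨2 * √n / (-((n : ℝ) / p) + 1) * K ^ ((p - 1) / p), by positivity, ?_⟩
  intro u hu hc hs x hx
  have hu1 : ContDiff ℝ 1 u := hu.of_le (by exact_mod_cast le_top)
  have hE : energy n γ p u = ∫⁻ z, energyDensity i γ p u z := by
    unfold energy energyDensity
    rw [lintegral_indicator (measurableSet_coord_pos i), hH]
    simp_rw [hi]
  rw [hH] at hs hx
  have hfin := lintegral_energyDensity_ne_top i (γ := γ) hp0 hu1 hc hs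
  have h0 (z) : 0 < z i ∨ u z = 0 :=
    or_iff_not_imp_left.2 fun h => image_eq_zero_of_notMem_tsupport fun hz => h (hs hz)
  have hz (z) : 0 < z i ∨ fderiv ℝ u z = 0 :=
    or_iff_not_imp_left.2 fun h => image_eq_zero_of_notMem_tsupport
      fun hz => h (hs (tsupport_fderiv_subset ℝ hz))
  have hx0 : 0 < x i := hx
  have key := enorm_le_of_forall_fderiv_eq_zero i hp (by simpa using hnp) hγ hu1 h0 hz x hx
  rw [← hE] at hfin key
  rw [← ENNReal.ofReal_toReal hfin, Fintype.card_fin, ← hK,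
    ENNReal.ofReal_rpow_of_nonneg (by positivity) (by positivity),
    ENNReal.ofReal_rpow_of_nonneg (by positivity) (by positivity),
    ← ENNReal.ofReal_mul (by positivity), ← ENNReal.ofReal_mul (by positivity),
    ← ENNReal.ofReal_mul (by positivity), ← ofReal_norm,
    ENNReal.ofReal_le_ofReal_iff (by positivity), Real.norm_eq_abs] at key
  refine key.trans (le_of_eq ?_)
  have e1 : 1 - ((n : ℝ) + γ) / p = (-((n : ℝ) / p) + 1) + -(γ / (p - 1)) * ((p - 1) / p) := by
    field_simp; ring
  rw [hi, e1, Real.rpow_add hx0 _ (-(γ / (p - 1)) * ((p - 1) / p)), Real.mul_rpow hK0.le (by positivity), Real.rpow_mul hx0.le]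
  ring
end
end
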